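/- arXiv:1511.02733 — 3 statements merged into one kernel-verified Lean document; each statement's English description precedes it below -/
import Mathlib

section
/- Straightening the dynamics on the torus (Lemma 2.1, Fourier form). Let n ≥ 1, γ, τ > 0 and let α ∈ ℝⁿ satisfy the Diophantine condition |k·α| ≥ γ/|k|^τ for all k ∈ ℤⁿ∖{0}. There exists a constant C₁ > 0, depending only on n and τ, with the following property: for every 0 < s < s+σ < 1 and every family g = (g_k)_{k∈ℤⁿ∖{0}} of complex numbers with |g|_{s+σ} < ∞, the unique family f = (f_k)_{k∈ℤⁿ} with f₀ = 0 and i(k·α)·f_k = g_k for all k ≠ 0 (i.e. the zero-average solution of the cohomological equation L_α f = g) satisfies |f|_s ≤ (C₁/γ)·σ^{−(n+τ)}·|g|_{s+σ}. -/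
open scoped BigOperators ENNReal

/-- The ℓ¹-norm `|k| = |k₁| + ⋯ + |kₙ|` of a multi-integer `k ∈ ℤⁿ`. -/
noncomputable def knorm {n : ℕ} (k : Fin n → ℤ) : ℝ := ∑ j, |(k j : ℝ)|

/-- `k·α = k₁α₁ + ⋯ + kₙαₙ`. -/
noncomputable def kdot {n : ℕ} (k : Fin n → ℤ) (α : Fin n → ℝ) : ℝ := ∑ j, (k j : ℝ) * α j

/-- The weighted norm `|g|_s = Σ_k |g_k| e^{|k|s}` of a family of Fourier coefficients. -/
noncomputable def wnorm {n : ℕ} (s : ℝ) (g : (Fin n → ℤ) → ℂ) : ℝ≥0∞ :=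
  ∑' k : Fin n → ℤ, (‖g k‖₊ : ℝ≥0∞) * ENNReal.ofReal (Real.exp (knorm k * s))

theorem knorm_pos {n : ℕ} {k : Fin n → ℤ} (hk : k ≠ 0) : 0 < knorm k := by
  obtain ⟨j, hj⟩ := Function.ne_iff.mp hk
  refine Finset.sum_pos' (fun _ _ => abs_nonneg _) ⟨j, Finset.mem_univ j, ?_⟩
  exact abs_pos.mpr (Int.cast_ne_zero.mpr hj)

theorem rpow_le_mul_exp {τ σ x : ℝ} (hτ : 0 < τ) (hσ : 0 < σ) (hx : 0 ≤ x) :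
    x ^ τ ≤ τ ^ τ * σ ^ (-τ) * Real.exp (x * σ) := by
  have h : x * σ / τ ≤ Real.exp (x * σ / τ) := by
    linarith [Real.add_one_le_exp (x * σ / τ)]
  have h' := Real.rpow_le_rpow (by positivity) h hτ.le
  rw [← Real.exp_mul, div_mul_cancel₀ _ hτ.ne', Real.div_rpow (by positivity) hτ.le,
    Real.mul_rpow hx hσ.le, div_le_iff₀ (by positivity)] at h'
  rw [Real.rpow_neg hσ.le, mul_assoc, mul_comm _⁻¹, ← mul_assoc, ← div_eq_mul_inv,
    le_div_iff₀ (by positivity)]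
  linarith

theorem wnorm_le_of_forall {n : ℕ} {s t c : ℝ} {f g : (Fin n → ℤ) → ℂ} (hc : 0 ≤ c)
    (h : ∀ k, ‖f k‖ * Real.exp (knorm k * s) ≤ c * (‖g k‖ * Real.exp (knorm k * t))) :
    wnorm s f ≤ ENNReal.ofReal c * wnorm t g := by
  rw [wnorm, wnorm, ← ENNReal.tsum_mul_left]
  refine ENNReal.tsum_le_tsum fun k => ?_
  have e (z : ℂ) : (‖z‖₊ : ℝ≥0∞) = ENNReal.ofReal ‖z‖ := (ofReal_norm z).symm
  rw [e, e, ← ENNReal.ofReal_mul (norm_nonneg _), ← ENNReal.ofReal_mul (norm_nonneg _),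
    ← ENNReal.ofReal_mul hc]
  exact ENNReal.ofReal_le_ofReal (h k)

/-- **Lemma 2.1** (straightening the dynamics on the torus, Fourier form).
If `α` is `(γ,τ)`-Diophantine, the zero-average solution `f` of the cohomological
equation `L_α f = g` (that is, `i(k·α) f_k = g_k` for `k ≠ 0`, `f₀ = 0`) exists, is
unique, and satisfies `|f|_s ≤ (C₁/γ) σ^{-(n+τ)} |g|_{s+σ}`, with `C₁` depending only
on `n` and `τ`. -/
theorem straightening_the_dynamics_on_the_torus (n : ℕ) (hn : 1 ≤ n) (τ : ℝ) (hτ : 0 < τ) :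
    ∃ C₁ : ℝ, 0 < C₁ ∧
      ∀ γ : ℝ, 0 < γ →
      ∀ α : Fin n → ℝ,
        (∀ k : Fin n → ℤ, k ≠ 0 → γ / knorm k ^ τ ≤ |kdot k α|) →
      ∀ s σ : ℝ, 0 < s → 0 < σ → s + σ < 1 →
      ∀ g : (Fin n → ℤ) → ℂ, g 0 = 0 → wnorm (s + σ) g < ⊤ →
        (∃! f : (Fin n → ℤ) → ℂ, f 0 = 0 ∧
            ∀ k : Fin n → ℤ, k ≠ 0 → Complex.I * (kdot k α : ℂ) * f k = g k) ∧
        ∀ f : (Fin n → ℤ) → ℂ, f 0 = 0 →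
          (∀ k : Fin n → ℤ, k ≠ 0 → Complex.I * (kdot k α : ℂ) * f k = g k) →
          wnorm s f ≤ ENNReal.ofReal (C₁ / γ * σ ^ (-((n : ℝ) + τ))) * wnorm (s + σ) g := by
  refine ⟨τ ^ τ, by positivity, fun γ hγ α hα s σ hs hσ hsσ g _ _ => ?_⟩
  have hdot (k : Fin n → ℤ) (hk : k ≠ 0) : kdot k α ≠ 0 :=
    abs_pos.mp ((div_pos hγ (Real.rpow_pos_of_pos (knorm_pos hk) τ)).trans_le (hα k hk))
  have hI (k : Fin n → ℤ) (hk : k ≠ 0) : Complex.I * (kdot k α : ℂ) ≠ 0 :=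
    mul_ne_zero Complex.I_ne_zero (Complex.ofReal_ne_zero.mpr (hdot k hk))
  refine ⟨⟨fun k => if k = 0 then 0 else g k / (Complex.I * (kdot k α : ℂ)),
    ⟨by simp, fun k hk => ?_⟩, ?_⟩, fun f hf0 hf => ?_⟩
  · simp only [hk, if_false]
    exact mul_div_cancel₀ _ (hI k hk)
  · rintro f ⟨hf0, hf⟩
    funext k
    by_cases hk : k = 0
    · simp [hk, hf0]
    · simp only [hk, if_false]
      exact eq_div_of_mul_eq (hI k hk) (by rw [mul_comm, hf k hk])
  · refine wnorm_le_of_forall (by positivity) fun k => ?_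
    by_cases hk : k = 0
    · simp only [hk, hf0, norm_zero, zero_mul]
      positivity
    · have hK : 0 < knorm k ^ τ := Real.rpow_pos_of_pos (knorm_pos hk) τ
      have hg : ‖g k‖ = |kdot k α| * ‖f k‖ := by
        rw [← hf k hk]
        simp
      have hfg : γ * ‖f k‖ ≤ knorm k ^ τ * ‖g k‖ := by
        have h := mul_le_mul_of_nonneg_right ((div_le_iff₀ hK).mp (hα k hk)) (norm_nonneg (f k))
        rw [hg]
        linarith
      have hσpow : σ ^ (-τ) ≤ σ ^ (-((n : ℝ) + τ)) :=
        Real.rpow_le_rpow_of_exponent_ge hσ (by linarith) (by linarith [n.cast_nonneg (α := ℝ)])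
      have hKσ : knorm k ^ τ ≤ τ ^ τ * σ ^ (-((n : ℝ) + τ)) * Real.exp (knorm k * σ) :=
        (rpow_le_mul_exp hτ hσ (knorm_pos hk).le).trans (by gcongr)
      rw [mul_add, Real.exp_add]
      calc ‖f k‖ * Real.exp (knorm k * s)
          = (γ * ‖f k‖) / γ * Real.exp (knorm k * s) := by rw [mul_div_cancel_left₀ _ hγ.ne']
        _ ≤ (τ ^ τ * σ ^ (-((n : ℝ) + τ)) * Real.exp (knorm k * σ) * ‖g k‖) / γ
              * Real.exp (knorm k * s) := by
            have h := hfg.trans (mul_le_mul_of_nonneg_right hKσ (norm_nonneg (g k)))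
            exact mul_le_mul_of_nonneg_right (div_le_div_of_nonneg_right h hγ.le)
              (Real.exp_pos _).le
        _ = _ := by ring
end

section
/- Relocating the torus (Lemma 2.2, scalar Fourier form). Let n ≥ 1, γ, τ > 0, α ∈ ℝⁿ and a ∈ ℂ satisfy the Diophantine condition |i(k·α) + a| ≥ γ/(1+|k|)^τ for all k ∈ ℤⁿ. There exists a constant C₂ > 0, depending only on n and τ, such that for every 0 < s < s+σ < 1 and every family g = (g_k)_{k∈ℤⁿ} of complex numbers with |g|_{s+σ} < ∞, the unique family f = (f_k)_{k∈ℤⁿ} with (i(k·α) + a)·f_k = g_k for all k ∈ ℤⁿ (i.e. the solution of (L_α + a)f = g) satisfies |f|_s ≤ (C₂/γ)·σ^{−(n+τ)}·|g|_{s+σ}. -/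
open scoped BigOperators ENNReal

lemma knorm_nonneg {n : ℕ} (k : Fin n → ℤ) : 0 ≤ knorm k :=
  Finset.sum_nonneg fun _ _ => abs_nonneg _

/-- `t ^ τ ≤ τ ^ τ * exp t` for `t ≥ 0` and `τ > 0`. -/
lemma rpow_le_rpow_self_mul_exp {t τ : ℝ} (ht : 0 ≤ t) (hτ : 0 < τ) :
    t ^ τ ≤ τ ^ τ * Real.exp t := by
  have h : t ≤ τ * Real.exp (t / τ) := by
    have h1 : t / τ ≤ Real.exp (t / τ) := by linarith [Real.add_one_le_exp (t / τ)]
    calc t = τ * (t / τ) := by field_simp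
      _ ≤ τ * Real.exp (t / τ) := by gcongr
  calc t ^ τ ≤ (τ * Real.exp (t / τ)) ^ τ := Real.rpow_le_rpow ht h hτ.le
    _ = τ ^ τ * Real.exp t := by
      rw [Real.mul_rpow hτ.le (Real.exp_pos _).le, ← Real.exp_mul, div_mul_cancel₀ _ hτ.ne']

/-- A polynomial loss is absorbed by an exponential weight of width `σ < 1`. -/
lemma one_add_rpow_le_mul_exp {x σ τ : ℝ} (hx : 0 ≤ x) (hσ : 0 < σ) (hσ1 : σ < 1)
    (hτ : 0 < τ) :
    (1 + x) ^ τ ≤ Real.exp 1 * τ ^ τ * σ ^ (-τ) * Real.exp (x * σ) := by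
  have h := rpow_le_rpow_self_mul_exp (t := (1 + x) * σ) (by positivity) hτ
  rw [Real.mul_rpow (by positivity) hσ.le] at h
  have hexp : Real.exp ((1 + x) * σ) ≤ Real.exp 1 * Real.exp (x * σ) := by
    rw [← Real.exp_add]
    exact Real.exp_le_exp.mpr (by linarith)
  have hσinv : σ ^ τ * σ ^ (-τ) = 1 := by
    rw [← Real.rpow_add hσ, add_neg_cancel, Real.rpow_zero]
  calc (1 + x) ^ τ = (1 + x) ^ τ * σ ^ τ * σ ^ (-τ) := by rw [mul_assoc, hσinv, mul_one]
    _ ≤ τ ^ τ * (Real.exp 1 * Real.exp (x * σ)) * σ ^ (-τ) := by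
      exact mul_le_mul_of_nonneg_right (h.trans (by gcongr)) (by positivity)
    _ = Real.exp 1 * τ ^ τ * σ ^ (-τ) * Real.exp (x * σ) := by ring

/-- **Lemma 2.2** (relocating the torus, scalar Fourier form).
If `α ∈ ℝⁿ` and `a ∈ ℂ` satisfy `|i(k·α) + a| ≥ γ/(1+|k|)^τ` for all `k ∈ ℤⁿ`, the
solution `f` of `(L_α + a) f = g`, i.e. `(i(k·α)+a) f_k = g_k` for all `k`, exists, is
unique, and satisfies `|f|_s ≤ (C₂/γ) σ^{-(n+τ)} |g|_{s+σ}`, with `C₂` depending only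
on `n` and `τ`. -/
theorem relocating_the_torus (n : ℕ) (hn : 1 ≤ n) (τ : ℝ) (hτ : 0 < τ) :
    ∃ C₂ : ℝ, 0 < C₂ ∧
      ∀ γ : ℝ, 0 < γ →
      ∀ (α : Fin n → ℝ) (a : ℂ),
        (∀ k : Fin n → ℤ, γ / (1 + knorm k) ^ τ ≤ ‖Complex.I * (kdot k α : ℂ) + a‖) →
      ∀ s σ : ℝ, 0 < s → 0 < σ → s + σ < 1 →
      ∀ g : (Fin n → ℤ) → ℂ, wnorm (s + σ) g < ⊤ →
        (∃! f : (Fin n → ℤ) → ℂ,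
            ∀ k : Fin n → ℤ, (Complex.I * (kdot k α : ℂ) + a) * f k = g k) ∧
        ∀ f : (Fin n → ℤ) → ℂ,
          (∀ k : Fin n → ℤ, (Complex.I * (kdot k α : ℂ) + a) * f k = g k) →
          wnorm s f ≤ ENNReal.ofReal (C₂ / γ * σ ^ (-((n : ℝ) + τ))) * wnorm (s + σ) g := by
  have hC : 0 < Real.exp 1 * τ ^ τ := mul_pos (Real.exp_pos 1) (Real.rpow_pos_of_pos hτ τ)
  refine ⟨Real.exp 1 * τ ^ τ, hC, ?_⟩
  intro γ hγ α a hdio s σ hs hσ hsσ g _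
  have hpow : ∀ k : Fin n → ℤ, 0 < (1 + knorm k) ^ τ := fun k =>
    Real.rpow_pos_of_pos (by linarith [knorm_nonneg k]) τ
  have hne : ∀ k : Fin n → ℤ, Complex.I * (kdot k α : ℂ) + a ≠ 0 := fun k =>
    norm_pos_iff.mp ((div_pos hγ (hpow k)).trans_le (hdio k))
  refine ⟨⟨fun k => g k / (Complex.I * (kdot k α : ℂ) + a),
    fun k => mul_div_cancel₀ _ (hne k), fun f hf => funext fun k => ?_⟩, fun f hf => ?_⟩
  · rw [eq_div_iff (hne k), mul_comm, hf k]
  · unfold wnorm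
    rw [← ENNReal.tsum_mul_left]
    refine ENNReal.tsum_le_tsum fun k => ?_
    have hσ_le : σ ^ (-τ) ≤ σ ^ (-((n : ℝ) + τ)) :=
      Real.rpow_le_rpow_of_exponent_ge hσ (by linarith)
        (by linarith [Nat.cast_nonneg (α := ℝ) n])
    have hf_le : ‖f k‖ ≤ (1 + knorm k) ^ τ / γ * ‖g k‖ := by
      have h := mul_le_mul_of_nonneg_right (hdio k) (norm_nonneg (f k))
      rw [← norm_mul, hf k] at h
      calc ‖f k‖ = (1 + knorm k) ^ τ / γ * (γ / (1 + knorm k) ^ τ * ‖f k‖) := by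
            have := (hpow k).ne'
            field_simp
        _ ≤ (1 + knorm k) ^ τ / γ * ‖g k‖ :=
            mul_le_mul_of_nonneg_left h (div_pos (hpow k) hγ).le
    have hreal : ‖f k‖ * Real.exp (knorm k * s) ≤
        Real.exp 1 * τ ^ τ / γ * σ ^ (-((n : ℝ) + τ)) *
          (‖g k‖ * Real.exp (knorm k * (s + σ))) := by
      calc ‖f k‖ * Real.exp (knorm k * s)
          ≤ (1 + knorm k) ^ τ / γ * ‖g k‖ * Real.exp (knorm k * s) := by gcongr
        _ ≤ (Real.exp 1 * τ ^ τ * σ ^ (-((n : ℝ) + τ)) * Real.exp (knorm k * σ)) / γ *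
              ‖g k‖ * Real.exp (knorm k * s) := by
            gcongr
            refine (one_add_rpow_le_mul_exp (knorm_nonneg k) hσ (by linarith) hτ).trans ?_
            gcongr
        _ = _ := by
            rw [mul_add, Real.exp_add]
            ring
    have hcoe : ∀ z : ℂ, (‖z‖₊ : ℝ≥0∞) = ENNReal.ofReal ‖z‖ := fun z =>
      (ofReal_norm z).symm
    rw [hcoe, hcoe, ← ENNReal.ofReal_mul (norm_nonneg _), ← ENNReal.ofReal_mul (norm_nonneg _),
      ← ENNReal.ofReal_mul (by positivity)]
    exact ENNReal.ofReal_le_ofReal hreal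
end

section
/- Push-forward of a Hamiltonian-dissipative vector field by an exact-symplectic transformation (Lemma 4.1). Let η ∈ ℝ, let φ : ℝⁿ → ℝⁿ be a C² diffeomorphism, S : ℝⁿ → ℝ of class C², and H : ℝⁿ×ℝⁿ → ℝ of class C². Define the diffeomorphism g(θ,r) = (φ(θ), (Dφ(θ)ᵀ)⁻¹·(r + ∇S(θ))) of ℝⁿ×ℝⁿ, and the vector field v(θ,r) = (∇_r H(θ,r), −∇_θ H(θ,r) − ηr). Then the push-forward g_*v := (Dg · v)∘g⁻¹ is given, at every point (Θ,R), by g_*v(Θ,R) = (∇_R Ĥ(Θ,R), −∇_Θ Ĥ(Θ,R) − ηR), where Ĥ(Θ,R) = H(g⁻¹(Θ,R)) − η·S(φ⁻¹(Θ)). -/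
open scoped RealInnerProductSpace

theorem fderiv_comp_fderiv_of_leftInverse {E F : Type*}
    [NormedAddCommGroup E] [NormedSpace ℝ E] [NormedAddCommGroup F] [NormedSpace ℝ F]
    {f : E → F} {g : F → E}
    (hgf : Function.LeftInverse g f) {x : E} (hg : DifferentiableAt ℝ g (f x))
    (hf : DifferentiableAt ℝ f x) (w : E) :
    fderiv ℝ g (f x) (fderiv ℝ f x w) = w := by
  have h : HasFDerivAt (g ∘ f) ((fderiv ℝ g (f x)).comp (fderiv ℝ f x)) x :=
    hg.hasFDerivAt.comp x hf.hasFDerivAt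
  rw [hgf.comp_eq_id] at h
  exact congrArg (fun T : E →L[ℝ] E => T w) (h.unique (hasFDerivAt_id x))

section Adjoint

variable {E F : Type*} [NormedAddCommGroup E] [InnerProductSpace ℝ E] [CompleteSpace E]
  [NormedAddCommGroup F] [InnerProductSpace ℝ F] [CompleteSpace F]

/-- The adjoint of real operators as a continuous linear map. -/
noncomputable def realAdjointCLM : (E →L[ℝ] F) →L[ℝ] (F →L[ℝ] E) :=
  LinearMap.mkContinuous
    { toFun := fun T => ContinuousLinearMap.adjoint T
      map_add' := fun T U => map_add _ T U
      map_smul' := fun c T => by simp } 1 (fun T => by simp)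

theorem realAdjointCLM_apply (T : E →L[ℝ] F) :
    realAdjointCLM T = ContinuousLinearMap.adjoint T := rfl

theorem inner_gradient_eq_fderiv (f : E → ℝ) (x w : E) :
    ⟪gradient f x, w⟫ = fderiv ℝ f x w := by
  simp [gradient]

theorem gradient_eq_adjoint_fderiv_one (f : E → ℝ) (x : E) :
    gradient f x = ContinuousLinearMap.adjoint (fderiv ℝ f x) 1 := by
  refine ext_inner_right ℝ fun w => ?_
  rw [inner_gradient_eq_fderiv, ContinuousLinearMap.adjoint_inner_left]
  simp

theorem hasFDerivAt_adjoint_fderiv {f : E → F} (hf : ContDiff ℝ 2 f) (x : E) :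
    HasFDerivAt (fun y => ContinuousLinearMap.adjoint (fderiv ℝ f y))
      (realAdjointCLM.comp (fderiv ℝ (fderiv ℝ f) x)) x := by
  have h : DifferentiableAt ℝ (fderiv ℝ f) x :=
    (hf.fderiv_right (m := 1) (by norm_num)).differentiable (by norm_num) x
  exact realAdjointCLM.hasFDerivAt.comp x h.hasFDerivAt

theorem hasFDerivAt_gradient {f : E → ℝ} (hf : ContDiff ℝ 2 f) (x : E) :
    HasFDerivAt (gradient f)
      ((realAdjointCLM.comp (fderiv ℝ (fderiv ℝ f) x)).flip 1) x := by
  have h := (hasFDerivAt_adjoint_fderiv hf x).clm_apply (hasFDerivAt_const (1 : ℝ) x)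
  simp only [← gradient_eq_adjoint_fderiv_one, ContinuousLinearMap.comp_zero, zero_add] at h
  exact h

theorem inner_adjoint_sndFDeriv_comm {f : E → F} (hf : ContDiff ℝ 2 f) (x u w : E) (r : F) :
    ⟪ContinuousLinearMap.adjoint (fderiv ℝ (fderiv ℝ f) x u) r, w⟫ =
      ⟪ContinuousLinearMap.adjoint (fderiv ℝ (fderiv ℝ f) x w) r, u⟫ := by
  have h : IsSymmSndFDerivAt ℝ f x := hf.contDiffAt.isSymmSndFDerivAt (by simp)
  rw [ContinuousLinearMap.adjoint_inner_left, ContinuousLinearMap.adjoint_inner_left, h.eq u w]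

end Adjoint

/-- **Lemma 4.1** (push-forward of a Hamiltonian-dissipative vector field by an
exact-symplectic transformation).  With `g(θ,r) = (φ(θ), (Dφ(θ)ᵀ)⁻¹(r + ∇S(θ)))` and
`v(θ,r) = (∇_r H, −∇_θ H − ηr)`, the push-forward `g_*v = (Dg·v)∘g⁻¹` is the
Hamiltonian-dissipative vector field of `Ĥ(Θ,R) = H(g⁻¹(Θ,R)) − η S(φ⁻¹(Θ))`:
`g_*v(Θ,R) = (∇_R Ĥ, −∇_Θ Ĥ − ηR)`.  Here `A θ` is the inverse of the transposed
Jacobian `Dφ(θ)ᵀ` (the adjoint of `fderiv ℝ φ θ`), `ψ = φ⁻¹`, and `Ginv = g⁻¹`. -/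
theorem pushforward_hamiltonian_dissipative (n : ℕ) (η : ℝ)
    (φv ψv : EuclideanSpace ℝ (Fin n) → EuclideanSpace ℝ (Fin n))
    (hφ : ContDiff ℝ 2 φv) (hψ : ContDiff ℝ 2 ψv)
    (hlr : Function.LeftInverse ψv φv) (hrl : Function.RightInverse ψv φv)
    (S : EuclideanSpace ℝ (Fin n) → ℝ) (hS : ContDiff ℝ 2 S)
    (H : EuclideanSpace ℝ (Fin n) × EuclideanSpace ℝ (Fin n) → ℝ) (hH : ContDiff ℝ 2 H)
    (A : EuclideanSpace ℝ (Fin n) → EuclideanSpace ℝ (Fin n) →L[ℝ] EuclideanSpace ℝ (Fin n))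
    (hA₁ : ∀ θ, (A θ).comp (ContinuousLinearMap.adjoint (fderiv ℝ φv θ)) =
      ContinuousLinearMap.id ℝ (EuclideanSpace ℝ (Fin n)))
    (hA₂ : ∀ θ, (ContinuousLinearMap.adjoint (fderiv ℝ φv θ)).comp (A θ) =
      ContinuousLinearMap.id ℝ (EuclideanSpace ℝ (Fin n)))
    (G Ginv V : EuclideanSpace ℝ (Fin n) × EuclideanSpace ℝ (Fin n) →
      EuclideanSpace ℝ (Fin n) × EuclideanSpace ℝ (Fin n))
    (hG : G = fun p => (φv p.1, A p.1 (p.2 + gradient S p.1)))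
    (hGinv : Ginv = fun p =>
      (ψv p.1, ContinuousLinearMap.adjoint (fderiv ℝ φv (ψv p.1)) p.2 - gradient S (ψv p.1)))
    (hV : V = fun p => (gradient (fun r => H (p.1, r)) p.2,
      -gradient (fun θ => H (θ, p.2)) p.1 - η • p.2))
    (Hhat : EuclideanSpace ℝ (Fin n) × EuclideanSpace ℝ (Fin n) → ℝ)
    (hHhat : Hhat = fun p => H (Ginv p) - η * S (ψv p.1)) :
    ∀ p : EuclideanSpace ℝ (Fin n) × EuclideanSpace ℝ (Fin n),
      fderiv ℝ G (Ginv p) (V (Ginv p)) =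
        (gradient (fun R => Hhat (p.1, R)) p.2,
          -gradient (fun Θ => Hhat (Θ, p.2)) p.1 - η • p.2) := by
  rintro ⟨Θ, R⟩
  have hφd : Differentiable ℝ φv := hφ.differentiable (by norm_num)
  have hψd : Differentiable ℝ ψv := hψ.differentiable (by norm_num)
  have hHd : Differentiable ℝ H := hH.differentiable (by norm_num)
  have hSd : Differentiable ℝ S := hS.differentiable (by norm_num)
  have hA : A = fun θ => ContinuousLinearMap.adjoint (fderiv ℝ ψv (φv θ)) := by
    funext θ
    have h : (fderiv ℝ φv θ).comp (ContinuousLinearMap.adjoint (A θ)) =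
        ContinuousLinearMap.id ℝ _ := by
      have := congrArg ContinuousLinearMap.adjoint (hA₁ θ)
      simpa [ContinuousLinearMap.adjoint_comp, ContinuousLinearMap.adjoint_id] using this
    rw [ContinuousLinearMap.eq_adjoint_iff]
    intro x y
    rw [← ContinuousLinearMap.adjoint_inner_right]
    congr 1
    have h₁ := fderiv_comp_fderiv_of_leftInverse hlr (hψd (φv θ)) (hφd θ)
      (ContinuousLinearMap.adjoint (A θ) y)
    have h₂ : fderiv ℝ φv θ (ContinuousLinearMap.adjoint (A θ) y) = y :=
      congrArg (fun T : _ →L[ℝ] _ => T y) h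
    rw [← h₁, h₂]
  have hGd : Differentiable ℝ G := by
    intro p
    have h₁ : DifferentiableAt ℝ (fun q : EuclideanSpace ℝ (Fin n) × EuclideanSpace ℝ (Fin n) =>
        A q.1) p := by
      rw [hA]
      exact (hasFDerivAt_adjoint_fderiv hψ (φv p.1)).differentiableAt.comp
        (f := fun q : EuclideanSpace ℝ (Fin n) × EuclideanSpace ℝ (Fin n) => φv q.1) p
        ((hφd p.1).comp p differentiableAt_fst)
    have h₂ : DifferentiableAt ℝ (fun q : EuclideanSpace ℝ (Fin n) × EuclideanSpace ℝ (Fin n) =>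
        gradient S q.1) p :=
      (hasFDerivAt_gradient hS p.1).differentiableAt.comp p differentiableAt_fst
    rw [hG]
    exact ((hφd p.1).comp p differentiableAt_fst).prodMk
      (h₁.clm_apply (differentiableAt_snd.add h₂))
  have hGG : Function.LeftInverse G Ginv := by
    rintro ⟨Θ', R'⟩
    have h := congrArg (fun T : _ →L[ℝ] _ => T R') (hA₁ (ψv Θ'))
    simp only [ContinuousLinearMap.comp_apply, ContinuousLinearMap.id_apply] at h
    simp only [hG, hGinv, sub_add_cancel, h, hrl Θ']
  set θ := ψv Θ with hθ
  set M := fderiv ℝ φv θ with hM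
  set K := fderiv ℝ ψv Θ with hK
  set N := fderiv ℝ (fderiv ℝ φv) θ with hN
  set T := fderiv ℝ (fderiv ℝ S) θ with hT
  have hφθ : φv θ = Θ := hrl Θ
  have hKM : ∀ u, K (M u) = u := fun u => by
    have := fderiv_comp_fderiv_of_leftInverse hlr (hψd (φv θ)) (hφd θ) u
    rwa [hφθ] at this
  set L : EuclideanSpace ℝ (Fin n) →L[ℝ] EuclideanSpace ℝ (Fin n) :=
    (realAdjointCLM.comp N).flip R - (realAdjointCLM.comp T).flip 1 with hL
  have hLsymm : ∀ u w, ⟪L u, w⟫ = ⟪L w, u⟫ := fun u w => by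
    have h₁ := inner_adjoint_sndFDeriv_comm hφ θ u w R
    have h₂ := inner_adjoint_sndFDeriv_comm hS θ u w 1
    simp only [hL, sub_apply, ContinuousLinearMap.flip_apply,
      ContinuousLinearMap.comp_apply, realAdjointCLM_apply, inner_sub_left]
    rw [h₁, h₂]
  set r := ContinuousLinearMap.adjoint M R - gradient S θ with hr
  have hGp : Ginv (Θ, R) = (θ, r) := by rw [hGinv]
  have hψ₁ : HasFDerivAt (fun p : EuclideanSpace ℝ (Fin n) × EuclideanSpace ℝ (Fin n) =>
      ψv p.1) (K.comp (ContinuousLinearMap.fst ℝ _ _)) (Θ, R) :=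
    (hψd Θ).hasFDerivAt.comp (Θ, R) hasFDerivAt_fst
  have hDGinv : HasFDerivAt Ginv
      ((K.comp (ContinuousLinearMap.fst ℝ _ _)).prod
        ((L.comp K).comp (ContinuousLinearMap.fst ℝ _ _) +
          (ContinuousLinearMap.adjoint M).comp (ContinuousLinearMap.snd ℝ _ _))) (Θ, R) := by
    have h₁ := (hasFDerivAt_adjoint_fderiv hφ θ).comp (Θ, R) hψ₁
    have h₂ := (hasFDerivAt_gradient hS θ).comp (Θ, R) hψ₁
    rw [hGinv]
    refine (hψ₁.prodMk ((h₁.clm_apply hasFDerivAt_snd).sub h₂)).congr_fderiv ?_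
    refine ContinuousLinearMap.ext fun w => ?_
    simp [hL, hN, hT, hM, hθ]
    abel
  have hHp : HasFDerivAt H (fderiv ℝ H (θ, r)) (θ, r) := (hHd _).hasFDerivAt
  have hHθ : ∀ u, ⟪gradient (fun θ' => H (θ', r)) θ, u⟫ = fderiv ℝ H (θ, r) (u, 0) := fun u => by
    have h : HasFDerivAt (fun θ' => H (θ', r)) _ θ := hHp.comp θ (hasFDerivAt_prodMk_left θ r)
    rw [inner_gradient_eq_fderiv, h.fderiv]
    simp
  have hHr : ∀ u, ⟪gradient (fun r' => H (θ, r')) r, u⟫ = fderiv ℝ H (θ, r) (0, u) := fun u => by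
    have h : HasFDerivAt (fun r' => H (θ, r')) _ r := hHp.comp r (hasFDerivAt_prodMk_right θ r)
    rw [inner_gradient_eq_fderiv, h.fderiv]
    simp
  have hDHhat : HasFDerivAt Hhat ((fderiv ℝ H (Ginv (Θ, R))).comp
      ((K.comp (ContinuousLinearMap.fst ℝ _ _)).prod
        ((L.comp K).comp (ContinuousLinearMap.fst ℝ _ _) +
          (ContinuousLinearMap.adjoint M).comp (ContinuousLinearMap.snd ℝ _ _))) -
      η • (fderiv ℝ S θ).comp (K.comp (ContinuousLinearMap.fst ℝ _ _))) (Θ, R) := by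
    rw [hHhat]
    exact ((hHd (Ginv (Θ, R))).hasFDerivAt.comp (Θ, R) hDGinv).sub
      (((hSd θ).hasFDerivAt.comp (Θ, R) hψ₁).const_mul η)
  set X := gradient (fun r' => H (θ, r')) r with hX
  have hgradR : gradient (fun R' => Hhat (Θ, R')) R = M X := by
    refine ext_inner_right ℝ fun u => ?_
    have h : HasFDerivAt (fun R' => Hhat (Θ, R')) _ R :=
      hDHhat.comp R (hasFDerivAt_prodMk_right Θ R)
    rw [inner_gradient_eq_fderiv, h.fderiv, ← ContinuousLinearMap.adjoint_inner_right, hHr]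
    simp [hGp]
  have hgradΘ : ∀ u, ⟪gradient (fun Θ' => Hhat (Θ', R)) Θ, M u⟫ =
      ⟪gradient (fun θ' => H (θ', r)) θ, u⟫ + ⟪X, L u⟫ - η * ⟪gradient S θ, u⟫ := fun u => by
    have h : HasFDerivAt (fun Θ' => Hhat (Θ', R)) _ Θ :=
      hDHhat.comp Θ (hasFDerivAt_prodMk_left Θ R)
    rw [inner_gradient_eq_fderiv, h.fderiv, hHr, hHθ, inner_gradient_eq_fderiv, ← map_add]
    simp [hGp, hKM]
  set Y := gradient (fun Θ' => Hhat (Θ', R)) Θ with hY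
  have key : V (Ginv (Θ, R)) = fderiv ℝ Ginv (Θ, R) (M X, -Y - η • R) := by
    rw [hDGinv.fderiv, hGp, hV]
    refine Prod.ext ?_ ?_
    · simp [hKM, hX]
    · refine ext_inner_right ℝ fun u => ?_
      simp only [ContinuousLinearMap.prod_apply, add_apply,
        ContinuousLinearMap.comp_apply, ContinuousLinearMap.coe_fst',
        ContinuousLinearMap.coe_snd', hKM, inner_add_left,
        ContinuousLinearMap.adjoint_inner_left, inner_sub_left, inner_neg_left, hgradΘ,
        inner_smul_left, hr, hLsymm X u, real_inner_comm X (L u)]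
      simp
      ring
  change fderiv ℝ G (Ginv (Θ, R)) (V (Ginv (Θ, R))) =
    (gradient (fun R' => Hhat (Θ, R')) R, -Y - η • R)
  rw [key, hgradR]
  exact fderiv_comp_fderiv_of_leftInverse hGG (hGd _) hDGinv.differentiableAt _
end
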